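/- Sampled-data stabilization of a finite-dimensional diagonal system: given λ_1 < ... < λ_m, g ∈ ℝ^m with all components nonzero, and k ∈ ℝ^m such that W = diag(-λ_1,...,-λ_m) + g k' is Hurwitz, there exist M, σ, T > 0 such that for every increasing sequence of sampling times τ_0 = 0 < τ_1 < ... with sup_i(τ_{i+1} - τ_i) ≤ T and τ_i → ∞, and every initial condition x_0 ∈ ℝ^m, the solution of ẋ_n = -λ_n x_n + g_n u with u(t) = k'x(τ_i) for t ∈ [τ_i, τ_{i+1}) satisfies |x(t)| + |u(t)| ≤ M e^{-σ t} |x_0| for all t ≥ 0. -/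

import Mathlib

open Filter Topology Matrix Set

attribute [local instance] Matrix.linftyOpNormedRing Matrix.linftyOpNormedAlgebra

/-- A matrix with spectrum in the open left half plane has an Euler step `1 + δ A` whose spectrum
lies in the open unit disc. -/
lemma exists_spectrum_one_add_smul_norm_lt_one {m : ℕ} (A : Matrix (Fin m) (Fin m) ℂ)
    (hA : ∀ μ ∈ spectrum ℂ A, μ.re < 0) :
    ∃ δ : ℝ, 0 < δ ∧ ∀ z ∈ spectrum ℂ (1 + (δ : ℂ) • A), ‖z‖ < 1 := by
  have key : ∀ᶠ δ : ℝ in 𝓝[>] 0, ∀ μ ∈ spectrum ℂ A, ‖1 + (δ : ℂ) * μ‖ < 1 := by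
    rw [eventually_all_finite (Matrix.finite_spectrum A)]
    intro μ hμ
    have hre := hA μ hμ
    have hlim : Tendsto (fun δ : ℝ => 2 * μ.re + δ * (μ.re ^ 2 + μ.im ^ 2)) (𝓝[>] 0)
        (𝓝 (2 * μ.re)) := by
      have : Continuous fun δ : ℝ => 2 * μ.re + δ * (μ.re ^ 2 + μ.im ^ 2) := by fun_prop
      simpa using (this.tendsto 0).mono_left nhdsWithin_le_nhds
    filter_upwards [hlim.eventually_lt_const (show 2 * μ.re < 0 by linarith),
      self_mem_nhdsWithin] with δ hδ hδ0
    rw [mem_Ioi] at hδ0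
    rw [← sq_lt_one_iff₀ (norm_nonneg _), Complex.sq_norm, Complex.normSq_apply]
    simp only [Complex.add_re, Complex.one_re, Complex.mul_re, Complex.ofReal_re, Complex.ofReal_im,
      Complex.add_im, Complex.one_im, Complex.mul_im]
    nlinarith [mul_neg_of_pos_of_neg hδ0 hδ]
  obtain ⟨δ, hδ, hδ0⟩ := (key.and self_mem_nhdsWithin).exists
  replace hδ0 : 0 < δ := hδ0
  refine ⟨δ, hδ0, fun z hz => ?_⟩
  have hδ' : (δ : ℂ) ≠ 0 := by exact_mod_cast hδ0.ne'
  have hw : z - 1 ∈ spectrum ℂ ((δ : ℂ) • A) := by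
    rw [← spectrum.add_mem_add_iff (s := 1), sub_add_cancel, map_one]
    exact hz
  have h2 : (δ : ℂ)⁻¹ * (z - 1) ∈ spectrum ℂ A := by
    rw [← spectrum.smul_mem_smul_iff (r := Units.mk0 (δ : ℂ) hδ')]
    simpa [Units.smul_def, hδ'] using hw
  have h3 := hδ _ h2
  rwa [mul_inv_cancel_left₀ hδ', add_sub_cancel] at h3

/-- Gelfand's formula: some power of an element of spectral radius `< 1` is dominated by a power
of a number `< 1`. -/
lemma exists_norm_pow_lt_pow {A : Type*} [NormedRing A] [NormedAlgebra ℂ A] [CompleteSpace A]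
    [Nontrivial A] (a : A) (ha : ∀ z ∈ spectrum ℂ a, ‖z‖ < 1) :
    ∃ n : ℕ, 0 < n ∧ ∃ r : ℝ, 0 < r ∧ r < 1 ∧ ‖a ^ n‖ < r ^ n := by
  have h1 : spectralRadius ℂ a < (1 : NNReal) :=
    spectrum.spectralRadius_lt_of_forall_lt a fun z hz => by exact_mod_cast ha z hz
  obtain ⟨r, hr, hr1⟩ := ENNReal.lt_iff_exists_nnreal_btwn.1 h1
  obtain ⟨n, hn, hn0⟩ := (((spectrum.pow_nnnorm_pow_one_div_tendsto_nhds_spectralRadius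
    a).eventually_lt_const hr).and (eventually_gt_atTop 0)).exists
  have hr0 : (0 : ENNReal) < r := lt_of_le_of_lt zero_le hr
  refine ⟨n, hn0, r, by exact_mod_cast hr0, by exact_mod_cast hr1, ?_⟩
  have hn' : (0 : ℝ) < n := by exact_mod_cast hn0
  have h2 := ENNReal.rpow_lt_rpow hn hn'
  rw [← ENNReal.rpow_mul, one_div, inv_mul_cancel₀ hn'.ne', ENNReal.rpow_one,
    ENNReal.rpow_natCast] at h2
  exact_mod_cast h2

lemma linfty_opNorm_map_ofReal {m : ℕ} (A : Matrix (Fin m) (Fin m) ℝ) :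
    ‖A.map Complex.ofReal‖ = ‖A‖ := by
  simp [Matrix.linfty_opNorm_def]

/-- If a power of `B` is dominated by `r ^ n`, then some seminorm equivalent to the norm is
contracted by `B` with factor `r`. -/
lemma exists_seminorm_mulVec_le {m n : ℕ} (hn : 0 < n) (B : Matrix (Fin m) (Fin m) ℝ) {r : ℝ}
    (hr : 0 < r) (hB : ‖B ^ n‖ ≤ r ^ n) :
    ∃ (N : Seminorm ℝ (Fin m → ℝ)) (K : ℝ), 0 < K ∧ (∀ v, ‖v‖ ≤ N v) ∧ (∀ v, N v ≤ K * ‖v‖) ∧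
      ∀ v, N (B *ᵥ v) ≤ r * N v := by
  refine ⟨Seminorm.of (fun v => ∑ j ∈ Finset.range n, (r ^ j)⁻¹ * ‖B ^ j *ᵥ v‖) ?_ ?_,
    1 + ∑ j ∈ Finset.range n, (r ^ j)⁻¹ * ‖B ^ j‖, by positivity, ?_, ?_, ?_⟩
  · intro v w
    rw [← Finset.sum_add_distrib]
    gcongr with j
    rw [← mul_add, mulVec_add]
    gcongr
    exact norm_add_le _ _
  · intro a v
    simp only [mulVec_smul, norm_smul, Finset.mul_sum]
    exact Finset.sum_congr rfl fun _ _ => by ring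
  · intro v
    change ‖v‖ ≤ ∑ j ∈ Finset.range n, (r ^ j)⁻¹ * ‖B ^ j *ᵥ v‖
    refine le_trans (by simp) (Finset.single_le_sum (f := fun j => (r ^ j)⁻¹ * ‖B ^ j *ᵥ v‖)
      (fun j _ => by positivity) (Finset.mem_range.2 hn))
  · intro v
    change ∑ j ∈ Finset.range n, (r ^ j)⁻¹ * ‖B ^ j *ᵥ v‖ ≤ _
    rw [add_mul, one_mul, Finset.sum_mul]
    refine le_add_of_nonneg_of_le (norm_nonneg _) (Finset.sum_le_sum fun j _ => ?_)
    rw [mul_assoc]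
    gcongr
    exact linfty_opNorm_mulVec _ _
  · intro v
    change ∑ j ∈ Finset.range n, (r ^ j)⁻¹ * ‖B ^ j *ᵥ (B *ᵥ v)‖ ≤
      r * ∑ j ∈ Finset.range n, (r ^ j)⁻¹ * ‖B ^ j *ᵥ v‖
    have hshift : ∀ j, (r ^ j)⁻¹ * ‖B ^ j *ᵥ (B *ᵥ v)‖ =
        r * ((r ^ (j + 1))⁻¹ * ‖B ^ (j + 1) *ᵥ v‖) := fun j => by
      rw [mulVec_mulVec, ← pow_succ, pow_succ r]
      field_simp
    rw [Finset.sum_congr rfl fun j _ => hshift j, ← Finset.mul_sum]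
    gcongr r * ?_
    have h1 := Finset.sum_range_succ (fun j => (r ^ j)⁻¹ * ‖B ^ j *ᵥ v‖) n
    rw [Finset.sum_range_succ'] at h1
    have h2 : (r ^ n)⁻¹ * ‖B ^ n *ᵥ v‖ ≤ ‖v‖ := by
      rw [inv_mul_le_iff₀ (by positivity)]
      exact (linfty_opNorm_mulVec _ _).trans (by gcongr)
    simp only [pow_zero, inv_one, one_mul, one_mulVec] at h1
    linarith

/-- A matrix with spectrum in the open left half plane admits a seminorm, equivalent to the norm,
which all short Euler steps contract. -/
lemma exists_seminorm_euler_step_le {m : ℕ} (hm : 0 < m) (A : Matrix (Fin m) (Fin m) ℝ)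
    (hA : ∀ μ ∈ spectrum ℂ (A.map Complex.ofReal), μ.re < 0) :
    ∃ (N : Seminorm ℝ (Fin m → ℝ)) (K c δ : ℝ), 0 < K ∧ 0 < c ∧ 0 < δ ∧ (∀ v, ‖v‖ ≤ N v) ∧
      (∀ v, N v ≤ K * ‖v‖) ∧
      ∀ h, 0 ≤ h → h ≤ δ → ∀ v, N (v + h • (A *ᵥ v)) ≤ (1 - c * h) * N v := by
  have : Nonempty (Fin m) := ⟨⟨0, hm⟩⟩
  obtain ⟨δ, hδ, hspec⟩ := exists_spectrum_one_add_smul_norm_lt_one _ hA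
  obtain ⟨n, hn, r, hr, hr1, hpow⟩ := exists_norm_pow_lt_pow _ hspec
  have hmap : 1 + (δ : ℂ) • A.map Complex.ofReal = (1 + δ • A).map Complex.ofReal := by
    ext i j
    by_cases hij : i = j <;> simp [hij]
  have hmap' : ((1 + δ • A).map Complex.ofReal) ^ n = ((1 + δ • A) ^ n).map Complex.ofReal :=
    (map_pow Complex.ofRealHom.mapMatrix (1 + δ • A) n).symm
  rw [hmap, hmap', linfty_opNorm_map_ofReal] at hpow
  obtain ⟨N, K, hK, hN1, hN2, hN3⟩ := exists_seminorm_mulVec_le hn (1 + δ • A) hr hpow.le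
  refine ⟨N, K, (1 - r) / δ, δ, hK, by have := sub_pos.2 hr1; positivity, hδ, hN1, hN2,
    fun h h0 hh v => ?_⟩
  have hdiv : h / δ ≤ 1 := (div_le_one hδ).2 hh
  have hdecomp : v + h • (A *ᵥ v) = (1 - h / δ) • v + (h / δ) • ((1 + δ • A) *ᵥ v) := by
    rw [add_mulVec, one_mulVec, smul_mulVec, smul_add, smul_smul, div_mul_cancel₀ _ hδ.ne',
      sub_smul, one_smul]
    abel
  have h0' : 0 ≤ h / δ := by positivity
  calc N (v + h • (A *ᵥ v))
      ≤ N ((1 - h / δ) • v) + N ((h / δ) • ((1 + δ • A) *ᵥ v)) := hdecomp ▸ map_add_le_add N _ _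
    _ = (1 - h / δ) * N v + h / δ * N ((1 + δ • A) *ᵥ v) := by
      rw [map_smul_eq_mul, map_smul_eq_mul, Real.norm_of_nonneg (sub_nonneg.2 hdiv),
        Real.norm_of_nonneg h0']
    _ ≤ (1 - h / δ) * N v + h / δ * (r * N v) := by gcongr; exact hN3 v
    _ = (1 - (1 - r) / δ * h) * N v := by ring

/-- The error of one Euler step for a scalar affine equation is quadratic in the step. -/
lemma abs_sub_euler_step_le {y : ℝ → ℝ} (hy : Continuous y) {a b l c L : ℝ} (hL : 0 < L)
    (hlL : |l| ≤ L) (hLb : L * (b - a) ≤ 1)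
    (hderiv : ∀ t ∈ Ioo a b, HasDerivAt y (-l * y t + c) t) {t : ℝ} (ht : t ∈ Icc a b) :
    |y t - (y a + (t - a) * (-l * y a + c))| ≤ 2 * L * (t - a) ^ 2 * |-l * y a + c| := by
  have hright : ∀ s ∈ Ico a b, HasDerivWithinAt y (-l * y s + c) (Ici s) s := by
    intro s hs
    have hsub : Ioo s b ⊆ Ioo a b := Ioo_subset_Ioo_left hs.1
    refine hasDerivWithinAt_Ici_of_tendsto_deriv (s := Ioo s b)
      (fun x hx => (hderiv x (hsub hx)).differentiableAt.differentiableWithinAt)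
      hy.continuousWithinAt (Ioo_mem_nhdsGT hs.2) ?_
    have hc : Continuous fun x => -l * y x + c := by fun_prop
    refine ((hc.tendsto s).mono_left nhdsWithin_le_nhds).congr' ?_
    filter_upwards [Ioo_mem_nhdsGT hs.2] with x hx
    exact (hderiv x (hsub hx)).deriv.symm
  set d := -l * y a + c with hd
  have hta : 0 ≤ t - a := sub_nonneg.2 ht.1
  have hbound := norm_le_gronwallBound_of_norm_deriv_right_le
    (f := fun s => y s - (y a + (s - a) * d)) (f' := fun s => -l * y s + c - d) (δ := 0) (K := L)
    (ε := L * ((t - a) * |d|)) (a := a) (b := t) (by fun_prop) (fun s hs => by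
      have h1 := (((hasDerivWithinAt_id s (Ici s)).sub_const a).mul_const d).const_add (y a)
      simpa [Pi.sub_def] using (hright s ⟨hs.1, hs.2.trans_le ht.2⟩).sub h1) (by simp) (fun s hs => by
      have hsa : 0 ≤ s - a := sub_nonneg.2 hs.1
      have heq : -l * y s + c - d = -l * (y s - (y a + (s - a) * d)) + -l * ((s - a) * d) := by
        rw [hd]; ring
      rw [heq]
      refine (norm_add_le _ _).trans ?_
      rw [norm_mul, norm_mul, norm_mul (s - a), norm_neg, Real.norm_of_nonneg hsa]
      have h2 : s - a ≤ t - a := by linarith [hs.2]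
      simp only [Real.norm_eq_abs]
      gcongr) t ⟨ht.1, le_rfl⟩
  have hLt : L * (t - a) ≤ 1 := le_trans (by gcongr; exact ht.2) hLb
  have hexp := Real.abs_exp_sub_one_le (x := L * (t - a))
    (by rwa [abs_of_nonneg (by positivity)])
  rw [abs_of_nonneg (show 0 ≤ L * (t - a) by positivity)] at hexp
  simp only [gronwallBound_of_K_ne_0 hL.ne', zero_mul, zero_add, mul_div_cancel_left₀ _ hL.ne',
    Real.norm_eq_abs] at hbound
  calc |y t - (y a + (t - a) * d)| ≤ (t - a) * |d| * (Real.exp (L * (t - a)) - 1) := hbound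
    _ ≤ (t - a) * |d| * (2 * (L * (t - a))) := by
      gcongr
      exact (le_abs_self _).trans hexp
    _ = 2 * L * (t - a) ^ 2 * |d| := by ring

/-- A strictly increasing unbounded sequence partitions the half line from its first term. -/
lemma exists_mem_Ico_of_tendsto {τ : ℕ → ℝ} (hτ : Tendsto τ atTop atTop) {t : ℝ} (ht : τ 0 ≤ t) :
    ∃ i, t ∈ Ico (τ i) (τ (i + 1)) := by
  by_contra! hcon
  have hle : ∀ i, τ i ≤ t := fun i => by
    induction i with
    | zero => exact ht
    | succ i ih => exact not_lt.1 fun h => hcon i ⟨ih, h⟩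
  obtain ⟨i, hi⟩ := (hτ.eventually_gt_atTop t).exists
  exact absurd (hle i) (not_le.2 hi)


/-- Sampled-data stabilization of a finite-dimensional diagonal system: if
W = diag(-λ) + g k' is Hurwitz, there exist M, σ, T > 0 such that for every sampling
schedule with gaps ≤ T, the zero-order-hold closed loop satisfies
|x(t)| + |u(t)| ≤ M e^{-σt} |x(0)|. -/
theorem stmt_7 (m : ℕ) (hm : 0 < m) (lam g k : Fin m → ℝ)
    (hlam : StrictMono lam) (hg : ∀ n, g n ≠ 0)
    (hW : ∀ μ ∈ spectrum ℂ
        (((Matrix.diagonal fun n => -lam n) + Matrix.of fun i j => g i * k j).map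
          (Complex.ofReal)), μ.re < 0) :
    ∃ M σ T : ℝ, 0 < M ∧ 0 < σ ∧ 0 < T ∧
      ∀ τ : ℕ → ℝ, StrictMono τ → τ 0 = 0 → (∀ i, τ (i + 1) - τ i ≤ T) →
        Filter.Tendsto τ Filter.atTop Filter.atTop →
        ∀ x : ℝ → EuclideanSpace ℝ (Fin m), ∀ u : ℝ → ℝ,
          Continuous x →
          (∀ i, ∀ t ∈ Set.Ico (τ i) (τ (i + 1)), u t = ∑ n, k n * x (τ i) n) →
          (∀ i, ∀ t ∈ Set.Ioo (τ i) (τ (i + 1)), ∀ n,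
            HasDerivAt (fun s => x s n) (-lam n * x t n + g n * u t) t) →
          ∀ t ≥ (0 : ℝ), ‖x t‖ + |u t| ≤ M * Real.exp (-σ * t) * ‖x 0‖ := by
  set A : Matrix (Fin m) (Fin m) ℝ :=
    (Matrix.diagonal fun n => -lam n) + Matrix.of fun i j => g i * k j with hAdef
  have hA : ∀ (v : Fin m → ℝ) n, (A *ᵥ v) n = -lam n * v n + g n * ∑ j, k j * v j := fun v n => by
    rw [hAdef, add_mulVec, Pi.add_apply, mulVec_diagonal]
    simp [mulVec, dotProduct, Finset.mul_sum, mul_assoc]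
  obtain ⟨N, K, c, δ, hK, hc, hδ, hN1, hN2, hN3⟩ := exists_seminorm_euler_step_le hm A hW
  obtain ⟨L, hL, hlamL⟩ : ∃ L : ℝ, 0 < L ∧ ∀ n, |lam n| ≤ L :=
    ⟨‖lam‖ + 1, by positivity, fun n => (norm_le_pi_norm lam n).trans (by simp)⟩
  set Q := K * (2 * L * ‖A‖) with hQ
  obtain ⟨T, hT, hTδ, hTL, hTQ⟩ : ∃ T : ℝ, 0 < T ∧ T ≤ δ ∧ L * T ≤ 1 ∧ Q * T ≤ c / 2 := by
    have hQ0 : 0 < Q + 1 := by positivity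
    refine ⟨min δ (min (1 / L) (c / 2 / (Q + 1))), by positivity, min_le_left _ _, ?_, ?_⟩
    · rw [← le_div_iff₀' hL]
      exact (min_le_right _ _).trans (min_le_left _ _)
    · have h1 : min δ (min (1 / L) (c / 2 / (Q + 1))) ≤ c / 2 / (Q + 1) :=
        (min_le_right _ _).trans (min_le_right _ _)
      have h2 : 0 < min δ (min (1 / L) (c / 2 / (Q + 1))) := by positivity
      rw [le_div_iff₀ hQ0] at h1
      linarith
  set E := ‖((EuclideanSpace.equiv (Fin m) ℝ).symm : (Fin m → ℝ) →L[ℝ] EuclideanSpace ℝ (Fin m))‖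
  have hEle : ∀ w : EuclideanSpace ℝ (Fin m), ‖w‖ ≤ E * ‖w.ofLp‖ := fun w =>
    ((EuclideanSpace.equiv (Fin m) ℝ).symm :
      (Fin m → ℝ) →L[ℝ] EuclideanSpace ℝ (Fin m)).le_opNorm w.ofLp
  have hle : ∀ w : EuclideanSpace ℝ (Fin m), ‖w.ofLp‖ ≤ ‖w‖ := fun w =>
    (pi_norm_le_iff_of_nonneg (norm_nonneg _)).2 fun i => PiLp.norm_apply_le w i
  set κ := ∑ n, |k n| with hκ
  have hκ0 : 0 ≤ κ := by positivity
  refine ⟨(E + κ * Real.exp (c / 2 * T)) * K + 1, c / 2, T, by positivity, by positivity, hT, ?_⟩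
  intro τ hτ hτ0 hgap hτlim x u hx hu hder t ht
  have hstep : ∀ i, ∀ s ∈ Icc (τ i) (τ (i + 1)),
      N (x s).ofLp ≤ Real.exp (-(c / 2) * (s - τ i)) * N (x (τ i)).ofLp := by
    intro i s hs
    set v := (x (τ i)).ofLp with hv
    have hh0 : 0 ≤ s - τ i := sub_nonneg.2 hs.1
    have hhT : s - τ i ≤ T := le_trans (by linarith [hs.2]) (hgap i)
    have herr : ‖(x s).ofLp - (v + (s - τ i) • (A *ᵥ v))‖ ≤
        2 * L * (s - τ i) ^ 2 * (‖A‖ * ‖v‖) := by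
      refine (pi_norm_le_iff_of_nonneg (by positivity)).2 fun n => ?_
      have hy : Continuous fun s => x s n := by fun_prop
      have h1 := abs_sub_euler_step_le hy (a := τ i) (b := τ (i + 1)) (l := lam n)
        (c := g n * ∑ j, k j * v j) hL (hlamL n)
        (le_trans (by gcongr; exact hgap i) hTL)
        (fun r hr => by
          have h2 := hder i r hr n
          rwa [hu i r ⟨hr.1.le, hr.2⟩] at h2) hs
      have h3 : |(A *ᵥ v) n| ≤ ‖A‖ * ‖v‖ :=
        (norm_le_pi_norm (A *ᵥ v) n).trans (linfty_opNorm_mulVec A v)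
      rw [← hA v n] at h1
      exact h1.trans (by gcongr)
    have hsplit := map_add_le_add N (v + (s - τ i) • (A *ᵥ v))
      ((x s).ofLp - (v + (s - τ i) • (A *ᵥ v)))
    rw [add_sub_cancel] at hsplit
    have hEuler := hN3 (s - τ i) hh0 (hhT.trans hTδ) v
    have herrN : N ((x s).ofLp - (v + (s - τ i) • (A *ᵥ v))) ≤ c / 2 * (s - τ i) * N v :=
      calc _ ≤ K * (2 * L * (s - τ i) ^ 2 * (‖A‖ * ‖v‖)) := (hN2 _).trans (by gcongr)
        _ = Q * (s - τ i) * (s - τ i) * ‖v‖ := by rw [hQ]; ring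
        _ ≤ Q * T * (s - τ i) * N v := by gcongr; exact hN1 v
        _ ≤ c / 2 * (s - τ i) * N v := by gcongr
    have hexp := mul_le_mul_of_nonneg_right (Real.add_one_le_exp (-(c / 2) * (s - τ i)))
      (apply_nonneg N v)
    linarith
  have hnode : ∀ i, N (x (τ i)).ofLp ≤ Real.exp (-(c / 2) * τ i) * N (x 0).ofLp := by
    intro i
    induction i with
    | zero => simp [hτ0]
    | succ i ih =>
      refine (hstep i _ ⟨(hτ (Nat.lt_add_one i)).le, le_rfl⟩).trans
        ((mul_le_mul_of_nonneg_left ih (Real.exp_pos _).le).trans_eq ?_)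
      rw [← mul_assoc, ← Real.exp_add]
      congr 2
      ring
  obtain ⟨i, hi⟩ := exists_mem_Ico_of_tendsto hτlim (t := t) (by rwa [hτ0])
  have hN0 : N (x 0).ofLp ≤ K * ‖x 0‖ := (hN2 _).trans (by gcongr; exact hle _)
  have hxt : ‖x t‖ ≤ E * (Real.exp (-(c / 2) * t) * (K * ‖x 0‖)) := by
    refine (hEle _).trans ?_
    gcongr
    refine (hN1 _).trans ((hstep i t ⟨hi.1, hi.2.le⟩).trans
      ((mul_le_mul_of_nonneg_left (hnode i) (Real.exp_pos _).le).trans ?_))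
    rw [← mul_assoc, ← Real.exp_add]
    have : -(c / 2) * (t - τ i) + -(c / 2) * τ i = -(c / 2) * t := by ring
    rw [this]
    gcongr
  have hut : |u t| ≤ κ * (Real.exp (c / 2 * T) * Real.exp (-(c / 2) * t) * (K * ‖x 0‖)) := by
    rw [hu i t hi]
    calc |∑ n, k n * x (τ i) n| ≤ ∑ n, |k n * x (τ i) n| := Finset.abs_sum_le_sum_abs _ _
      _ ≤ ∑ n, |k n| * ‖(x (τ i)).ofLp‖ := by
        gcongr with n
        rw [abs_mul]
        gcongr
        exact norm_le_pi_norm (x (τ i)).ofLp n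
      _ = κ * ‖(x (τ i)).ofLp‖ := by rw [hκ, Finset.sum_mul]
      _ ≤ κ * (Real.exp (-(c / 2) * τ i) * (K * ‖x 0‖)) := by
        gcongr
        exact (hN1 _).trans ((hnode i).trans (by gcongr))
      _ ≤ _ := by
        rw [← Real.exp_add]
        gcongr
        have h1 : t - τ i ≤ T := by linarith [hgap i, hi.2]
        nlinarith
  have hpos : 0 ≤ Real.exp (-(c / 2) * t) * ‖x 0‖ := by positivity
  linarith
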